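/- Let A be a finite dimensional algebra over a field k with global dimension at most 1, and let P be a 2-term silting complex in K^b(proj A). Then the endomorphism algebra B = End_{D^b(A)}(P) has global dimension at most 3. -/

import Mathlib

/-!
Common setup: we model right `A`-modules as `ModuleCat Aᵐᵒᵖ`, the bounded derived
category `D^b(mod A)` as the full subcategory (given by the predicate `InDb`) of the
derived category of `Mod Aᵐᵒᵖ` consisting of cohomologically bounded complexes with
finitely generated cohomology, and `K^b(proj A)` via bounded complexes of finitely
generated projective modules (`IsPerfCplx`).
-/

namespace TwoTermSilting

open CategoryTheory Limits Pretriangulated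

universe w v u

noncomputable section

/-- The projective dimension of the module `M` is at most `n`. -/
def pdLE (R : Type u) [Ring R] : ℕ → ModuleCat.{v} R → Prop
  | 0, M => Projective M
  | (n+1), M => ∃ (P : ModuleCat.{v} R) (f : P ⟶ M),
      Projective P ∧ Epi f ∧ pdLE R n (kernel f)

/-- The (right) global dimension of `R` is at most `d`: every finitely generated
module has projective dimension at most `d`. -/
def gldLE (R : Type u) [Ring R] (d : ℕ) : Prop :=
  ∀ M : ModuleCat.{v} R, Module.Finite R M → pdLE R d M

section Star

variable {C : Type u} [Category.{v} C] [HasZeroObject C] [Preadditive C] [HasShift C ℤ]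
  [∀ n : ℤ, (shiftFunctor C n).Additive] [Pretriangulated C]

/-- `star S T` consists of the objects `Z` sitting in a distinguished triangle
`X ⟶ Z ⟶ Y ⟶ X⟦1⟧` with `X ∈ S` and `Y ∈ T`. -/
def star (S T : Set C) : Set C :=
  {Z | ∃ (X Y : C) (f : X ⟶ Z) (g : Z ⟶ Y) (h : Y ⟶ X⟦(1 : ℤ)⟧),
    X ∈ S ∧ Y ∈ T ∧ Triangle.mk f g h ∈ distTriang C}

/-- `starChain f n` is the iterated star product `f 0 * f 1 * ⋯ * f n`
(the star operation being associative). -/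
def starChain (f : ℕ → Set C) : ℕ → Set C
  | 0 => f 0
  | (n+1) => star (starChain f n) (f (n+1))

/-- The closure of a class of objects under the shift by `n`. -/
def shiftSet (S : Set C) (n : ℤ) : Set C :=
  {Y | ∃ X ∈ S, Nonempty (Y ≅ X⟦n⟧)}

/-- The additive closure of the object `X`: all direct summands of finite direct sums
of copies of `X`. -/
def addOf (X : C) : Set C :=
  {Y | ∃ (n : ℕ) (ι : Y ⟶ ⨁ (fun _ : Fin n => X)) (r : (⨁ (fun _ : Fin n => X)) ⟶ Y),
    ι ≫ r = 𝟙 Y}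

/-- A class of objects of a (pre)triangulated category is thick if it is closed under
isomorphisms, shifts, extensions and direct summands. -/
def IsThick (S : Set C) : Prop :=
  (∀ ⦃X Y : C⦄, (X ≅ Y) → X ∈ S → Y ∈ S) ∧
  (∀ (X : C) (n : ℤ), X ∈ S → (X⟦n⟧) ∈ S) ∧
  (∀ T : Triangle C, (T ∈ distTriang C) → T.obj₁ ∈ S → T.obj₃ ∈ S → T.obj₂ ∈ S) ∧
  (∀ (X Y : C) (ι : X ⟶ Y) (r : Y ⟶ X), ι ≫ r = 𝟙 X → Y ∈ S → X ∈ S)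

end Star

/-- The right `End Y`-module structure on `Y ⟶ X`, by precomposition. -/
instance endModule {C : Type u} [Category.{v} C] [Preadditive C] (Y X : C) :
    Module (End Y)ᵐᵒᵖ (Y ⟶ X) where
  smul b f := b.unop ≫ f
  one_smul f := Category.id_comp f
  mul_smul b₁ b₂ f := by
    show (b₁ * b₂).unop ≫ f = b₁.unop ≫ (b₂.unop ≫ f)
    have h : (b₁ * b₂).unop = b₁.unop ≫ b₂.unop := rfl
    rw [h, Category.assoc]
  smul_zero b := Limits.comp_zero
  smul_add b f g := Preadditive.comp_add _ _ _ _ _ _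
  add_smul b₁ b₂ f := Preadditive.add_comp _ _ _ _ _ _
  zero_smul f := Limits.zero_comp

section Main

variable (R : Type) [Ring R] [HasDerivedCategory.{w} (ModuleCat.{0} R)]

/-- A bounded complex of finitely generated projective modules
(an object of `K^b(proj R)`). -/
def IsPerfCplx (X : CochainComplex (ModuleCat.{0} R) ℤ) : Prop :=
  (∀ i, Projective (X.X i)) ∧ (∀ i, Module.Finite R (X.X i)) ∧
    ∃ a b : ℤ, ∀ i, (i < a ∨ b < i) → IsZero (X.X i)

/-- A complex of finitely generated projective modules concentrated in
degrees `-1` and `0`. -/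
def IsTwoTermCplx (X : CochainComplex (ModuleCat.{0} R) ℤ) : Prop :=
  (∀ i, Projective (X.X i)) ∧ (∀ i, Module.Finite R (X.X i)) ∧
    ∀ i, i ≠ -1 → i ≠ 0 → IsZero (X.X i)

/-- A two-term silting complex: a two-term complex of finitely generated projectives `P`
with `Hom_D(P, P[1]) = 0`, such that the smallest thick subcategory containing `P`
contains all of `K^b(proj R)`. -/
def IsTwoTermSilting (P : CochainComplex (ModuleCat.{0} R) ℤ) : Prop :=
  IsTwoTermCplx R P ∧
  (∀ f : DerivedCategory.Q.obj P ⟶ (DerivedCategory.Q.obj P)⟦(1 : ℤ)⟧, f = 0) ∧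
  (∀ S : Set (DerivedCategory (ModuleCat.{0} R)), IsThick S →
    DerivedCategory.Q.obj P ∈ S →
    ∀ X : CochainComplex (ModuleCat.{0} R) ℤ, IsPerfCplx R X → DerivedCategory.Q.obj X ∈ S)

/-- The objects of the derived category which belong to `D^b(mod R)`: cohomologically
bounded complexes with finitely generated cohomology. -/
def InDb (X : DerivedCategory (ModuleCat.{0} R)) : Prop :=
  (∃ a b : ℤ, ∀ i, (i < a ∨ b < i) →
    IsZero ((DerivedCategory.homologyFunctor (ModuleCat.{0} R) i).obj X)) ∧
  (∀ i : ℤ, Module.Finite R ((DerivedCategory.homologyFunctor (ModuleCat.{0} R) i).obj X))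

variable {R}

/-- The torsion class `T(P)` of finitely generated modules `X` with `Hom_D(P, X[1]) = 0`. -/
def TT (P : CochainComplex (ModuleCat.{0} R) ℤ) : Set (ModuleCat.{0} R) :=
  {X | Module.Finite R X ∧
    ∀ f : DerivedCategory.Q.obj P ⟶
      ((DerivedCategory.singleFunctor (ModuleCat.{0} R) 0).obj X)⟦(1 : ℤ)⟧, f = 0}

/-- The torsion-free class `F(P)` of finitely generated modules `Y` with `Hom_D(P, Y) = 0`. -/
def FF (P : CochainComplex (ModuleCat.{0} R) ℤ) : Set (ModuleCat.{0} R) :=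
  {Y | Module.Finite R Y ∧
    ∀ f : DerivedCategory.Q.obj P ⟶
      (DerivedCategory.singleFunctor (ModuleCat.{0} R) 0).obj Y, f = 0}

/-- The heart `C(P) = {X ∈ D^b(mod R) | Hom_D(P, X[i]) = 0 for all i ≠ 0}`. -/
def CP (P : CochainComplex (ModuleCat.{0} R) ℤ) : Set (DerivedCategory (ModuleCat.{0} R)) :=
  {X | InDb R X ∧ ∀ i : ℤ, i ≠ 0 → ∀ f : DerivedCategory.Q.obj P ⟶ X⟦i⟧, f = 0}

end Main

section Vanishing

variable {C : Type u} [Category.{w} C] [Preadditive C] [HasShift C ℤ]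

/-- Every morphism from `W` to the `i`-th shift of `X` is zero. -/
def HomVanish (W X : C) (i : ℤ) : Prop := ∀ f : W ⟶ X⟦i⟧, f = 0

lemma homVanish_of_mono {W X Y : C} {i j : ℤ} (g : X⟦i⟧ ⟶ Y⟦j⟧) [Mono g]
    (h : HomVanish W Y j) : HomVanish W X i :=
  fun f => (cancel_mono g).1 ((h (f ≫ g)).trans zero_comp.symm)

lemma homVanish_zero_iff {W X : C} : HomVanish W X 0 ↔ ∀ f : W ⟶ X, f = 0 := by
  refine ⟨fun h f => ?_, fun h f => ?_⟩
  · rw [← cancel_mono ((shiftFunctorZero C ℤ).inv.app X), zero_comp]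
    exact h _
  · rw [← cancel_mono ((shiftFunctorZero C ℤ).hom.app X), zero_comp]
    exact h _

lemma homVanish_shift {W X : C} {a i j : ℤ} (hij : a + i = j) :
    HomVanish W (X⟦a⟧) i ↔ HomVanish W X j :=
  ⟨homVanish_of_mono ((shiftFunctorAdd' C a i j hij).hom.app X),
    homVanish_of_mono ((shiftFunctorAdd' C a i j hij).inv.app X)⟩

variable [∀ n : ℤ, (shiftFunctor C n).Additive]

lemma homVanish_shift_shift {W X : C} {a i j : ℤ} (hij : j + a = i) :
    HomVanish (W⟦a⟧) X i ↔ HomVanish W X j := by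
  have e : X⟦i⟧ ≅ X⟦j⟧⟦a⟧ := (shiftFunctorAdd' C j a i hij).app X
  refine ⟨fun h f => ?_, fun h f => ?_⟩
  · apply (shiftFunctor C a).map_injective
    rw [← cancel_mono e.inv, Functor.map_zero, zero_comp]
    exact h _
  · obtain ⟨g, hg⟩ := (shiftFunctor C a).map_surjective (f ≫ e.hom)
    rw [← cancel_mono e.hom, ← hg, h g, Functor.map_zero, zero_comp]

variable [HasZeroObject C] [Pretriangulated C]

lemma exists_lift_of_distTriang {W : C} {T : Triangle C} (hT : T ∈ distTriang C) (i : ℤ)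
    (x : W ⟶ T.obj₂⟦i⟧) (hx : x ≫ T.mor₂⟦i⟧' = 0) : ∃ y : W ⟶ T.obj₁⟦i⟧, x = y ≫ T.mor₁⟦i⟧' := by
  have hx' : x ≫ (i.negOnePow • T.mor₂⟦i⟧') = 0 := by
    rw [Linear.comp_units_smul, hx, smul_zero]
  obtain ⟨y, hy⟩ := Triangle.coyoneda_exact₂ _ (Triangle.shift_distinguished _ hT i) x hx'
  refine ⟨i.negOnePow • (show W ⟶ T.obj₁⟦i⟧ from y), ?_⟩
  rw [Linear.units_smul_comp, ← Linear.comp_units_smul]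
  exact hy

lemma eq_zero_of_distTriang {X : C} {T : Triangle C} (hT : T ∈ distTriang C)
    (h₁ : ∀ f : T.obj₁ ⟶ X, f = 0) (h₃ : ∀ f : T.obj₃ ⟶ X, f = 0) (f : T.obj₂ ⟶ X) : f = 0 := by
  obtain ⟨g, rfl⟩ := Triangle.yoneda_exact₂ _ hT f (h₁ _)
  rw [h₃ g, comp_zero]

lemma HomVanish.mid {W : C} {T : Triangle C} (hT : T ∈ distTriang C) {i : ℤ}
    (h₁ : HomVanish W T.obj₁ i) (h₃ : HomVanish W T.obj₃ i) : HomVanish W T.obj₂ i := by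
  intro f
  obtain ⟨y, rfl⟩ := exists_lift_of_distTriang hT i f (h₃ _)
  rw [h₁ y, zero_comp]

lemma HomVanish.right {W : C} {T : Triangle C} (hT : T ∈ distTriang C) {i : ℤ}
    (h₂ : HomVanish W T.obj₂ i) (h₁ : HomVanish W T.obj₁ (i + 1)) : HomVanish W T.obj₃ i :=
  HomVanish.mid (rot_of_distTriang _ hT) h₂ ((homVanish_shift (add_comm _ _)).2 h₁)

lemma HomVanish.left {W : C} {T : Triangle C} (hT : T ∈ distTriang C) {i j : ℤ} (hij : j + 1 = i)
    (h₃ : HomVanish W T.obj₃ j) (h₂ : HomVanish W T.obj₂ i) : HomVanish W T.obj₁ i :=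
  HomVanish.mid (inv_rot_of_distTriang _ hT) ((homVanish_shift (by lia)).2 h₃) h₂

end Vanishing

section Approximation

variable {C : Type u} [Category.{w} C] [Preadditive C] [HasShift C ℤ]
  (k : Type) [Field k] [Linear k C] {P : C}

lemma finite_hom_of_mono {W X Y : C} {i j : ℤ} (g : X⟦i⟧ ⟶ Y⟦j⟧) [Mono g]
    (h : Module.Finite k (W ⟶ Y⟦j⟧)) : Module.Finite k (W ⟶ X⟦i⟧) :=
  Module.Finite.of_injective (Linear.rightComp k W g) fun _ _ h => (cancel_mono g).1 h

lemma finite_hom_shift {W X : C} {a i j : ℤ} (hij : a + i = j) :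
    Module.Finite k (W ⟶ X⟦a⟧⟦i⟧) ↔ Module.Finite k (W ⟶ X⟦j⟧) :=
  ⟨finite_hom_of_mono k ((shiftFunctorAdd' C a i j hij).hom.app X),
    finite_hom_of_mono k ((shiftFunctorAdd' C a i j hij).inv.app X)⟩

lemma finite_hom_zero {W X : C} :
    Module.Finite k (W ⟶ X⟦(0 : ℤ)⟧) ↔ Module.Finite k (W ⟶ X) :=
  ⟨fun _ => Module.Finite.of_injective
      (Linear.rightComp k W ((shiftFunctorZero C ℤ).inv.app X : X ⟶ X⟦(0 : ℤ)⟧)) fun _ _ h => (cancel_mono _).1 h,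
    fun _ => by
      let f : X⟦(0 : ℤ)⟧ ⟶ X := (shiftFunctorZero C ℤ).hom.app X
      have : Mono f := inferInstanceAs (Mono ((shiftFunctorZero C ℤ).hom.app X))
      exact Module.Finite.of_injective (Linear.rightComp k W f) fun _ _ h => (cancel_mono f).1 h⟩

lemma HomVanish.finite {W X : C} {i : ℤ} (h : HomVanish W X i) : Module.Finite k (W ⟶ X⟦i⟧) := by
  have : Subsingleton (W ⟶ X⟦i⟧) := ⟨fun f g => (h f).trans (h g).symm⟩
  infer_instance

variable (P) in
/-- The object `X` is connective with respect to `P`, with finite dimensional spaces of morphisms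
from `P` to the shifts of `X`. -/
structure IsConnective (X : C) : Prop where
  vanish : ∀ i : ℤ, 1 ≤ i → HomVanish P X i
  finite : ∀ i : ℤ, Module.Finite k (P ⟶ X⟦i⟧)

variable {k} in
lemma IsConnective.shift {X : C} (hX : IsConnective k P X) {a : ℤ} (ha : 0 ≤ a) :
    IsConnective k P (X⟦a⟧) where
  vanish i hi := (homVanish_shift rfl).2 (hX.vanish (a + i) (by lia))
  finite i := (finite_hom_shift k rfl).2 (hX.finite (a + i))

variable {k} in
lemma IsConnective.of_retract {X Y : C} (hX : IsConnective k P X) (r : Retract Y X) :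
    IsConnective k P Y where
  vanish i hi := homVanish_of_mono (r.i⟦i⟧') (hX.vanish i hi)
  finite i := finite_hom_of_mono k (r.i⟦i⟧') (hX.finite i)

variable [∀ n : ℤ, (shiftFunctor C n).Additive] [HasZeroObject C] [Pretriangulated C]

variable (P) in
/-- The direct sum of `n` copies of `P`. -/
abbrev copies (n : ℕ) : C := ⨁ fun _ : Fin n => P

lemma copies_shift_hom_ext {W : C} {n : ℕ} {i : ℤ} {f g : W ⟶ (copies P n)⟦i⟧}
    (h : ∀ j, f ≫ (biproduct.π (fun _ : Fin n => P) j)⟦i⟧' =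
      g ≫ (biproduct.π (fun _ : Fin n => P) j)⟦i⟧') : f = g := by
  have key : ∀ f : W ⟶ (copies P n)⟦i⟧, f = ∑ j, (f ≫ (biproduct.π (fun _ : Fin n => P) j)⟦i⟧') ≫
      (biproduct.ι (fun _ : Fin n => P) j)⟦i⟧' := fun f => by
    simp only [Category.assoc, ← Functor.map_comp, ← Preadditive.comp_sum, ← Functor.map_sum]
    rw [biproduct.total, CategoryTheory.Functor.map_id, Category.comp_id]
  rw [key f, key g]
  simp only [h]

lemma HomVanish.to_copies {W : C} {i : ℤ} (h : HomVanish W P i) (n : ℕ) :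
    HomVanish W (copies P n) i :=
  fun _ => copies_shift_hom_ext fun _ => (h _).trans (h _).symm

lemma HomVanish.from_copies {X : C} {i : ℤ} (h : HomVanish P X i) (n : ℕ) :
    HomVanish (copies P n) X i :=
  fun _ => biproduct.hom_ext' _ _ fun _ => (h _).trans (h _).symm

lemma finite_hom_copies {W : C} {i : ℤ} (n : ℕ) [Module.Finite k (W ⟶ P⟦i⟧)] :
    Module.Finite k (W ⟶ (copies P n)⟦i⟧) :=
  Module.Finite.of_injective
    (LinearMap.pi fun j => Linear.rightComp k W ((biproduct.π (fun _ : Fin n => P) j)⟦i⟧'))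
    fun _ _ h => copies_shift_hom_ext fun j => congr_fun h j

lemma finite_hom_mid {W : C} {T : Triangle C} (hT : T ∈ distTriang C) {i : ℤ}
    (h₁ : Module.Finite k (W ⟶ T.obj₁⟦i⟧)) (h₃ : Module.Finite k (W ⟶ T.obj₃⟦i⟧)) :
    Module.Finite k (W ⟶ T.obj₂⟦i⟧) := by
  have hker : (LinearMap.ker (Linear.rightComp k W (T.mor₂⟦i⟧'))).FG := by
    have : LinearMap.ker (Linear.rightComp k W (T.mor₂⟦i⟧')) ≤
        LinearMap.range (Linear.rightComp k W (T.mor₁⟦i⟧')) := fun x hx => by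
      obtain ⟨y, rfl⟩ := exists_lift_of_distTriang hT i x hx
      exact ⟨y, rfl⟩
    exact Submodule.FG.of_le (Submodule.fg_iff_finiteDimensional _ |>.2 inferInstance) this
  have : Module.Finite k (LinearMap.ker (Linear.rightComp k W (T.mor₂⟦i⟧'))) :=
    Module.Finite.iff_fg.2 hker
  have : Module.Finite k (_ ⧸ LinearMap.ker (Linear.rightComp k W (T.mor₂⟦i⟧'))) :=
    Module.Finite.equiv (LinearMap.quotKerEquivRange _).symm
  exact Module.Finite.of_submodule_quotient (LinearMap.ker (Linear.rightComp k W (T.mor₂⟦i⟧')))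

variable {k}

lemma IsConnective.copies (hP : IsConnective k P P) (n : ℕ) : IsConnective k P (copies P n) where
  vanish i hi := (hP.vanish i hi).to_copies n
  finite i := have := hP.finite i; finite_hom_copies k n

lemma IsConnective.mid {T : Triangle C} (hT : T ∈ distTriang C)
    (h₁ : IsConnective k P T.obj₁) (h₃ : IsConnective k P T.obj₃) : IsConnective k P T.obj₂ where
  vanish i hi := (h₁.vanish i hi).mid hT (h₃.vanish i hi)
  finite i := finite_hom_mid k hT (h₁.finite i) (h₃.finite i)

lemma IsConnective.right {T : Triangle C} (hT : T ∈ distTriang C)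
    (h₁ : IsConnective k P T.obj₁) (h₂ : IsConnective k P T.obj₂) : IsConnective k P T.obj₃ :=
  IsConnective.mid (rot_of_distTriang _ hT) h₂ (h₁.shift zero_le_one)

variable (k) in
lemma exists_copies_hom (X : C) [Module.Finite k (P ⟶ X)] :
    ∃ (n : ℕ) (f : copies P n ⟶ X), ∀ g : P ⟶ X, ∃ h : P ⟶ copies P n, g = h ≫ f := by
  obtain ⟨n, s, hs⟩ := Module.Finite.exists_fin (R := k) (M := P ⟶ X)
  refine ⟨n, biproduct.desc s, fun g => ?_⟩
  obtain ⟨c, rfl⟩ := (Submodule.mem_span_range_iff_exists_fun k).1 (hs ▸ Submodule.mem_top (x := g))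
  refine ⟨∑ j, c j • biproduct.ι (fun _ : Fin n => P) j, ?_⟩
  simp [Preadditive.sum_comp]

lemma IsConnective.exists_approximation (hP : IsConnective k P P) {X : C}
    (hX : IsConnective k P X) :
    ∃ (n : ℕ) (K : C) (a : K ⟶ TwoTermSilting.copies P n) (b : TwoTermSilting.copies P n ⟶ X)
      (c : X ⟶ K⟦(1 : ℤ)⟧),
      Triangle.mk a b c ∈ distTriang C ∧ IsConnective k P K := by
  have := (finite_hom_zero k).1 (hX.finite 0)
  obtain ⟨n, b, hb⟩ := exists_copies_hom k (P := P) X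
  obtain ⟨K, a, c, hT⟩ := distinguished_cocone_triangle₁ b
  have hT' := inv_rot_of_distTriang _ hT
  refine ⟨n, K, a, b, c, hT, fun i hi => ?_, fun i => ?_⟩
  · obtain rfl | hi := hi.eq_or_lt
    · have hbc : b ≫ c = 0 := comp_distTriang_mor_zero₂₃ _ hT
      have hc : ∀ g : P ⟶ X, g ≫ c = 0 := fun g => by
        obtain ⟨h, rfl⟩ := hb g
        rw [Category.assoc, hbc, comp_zero]
      intro f
      obtain ⟨g, rfl⟩ := Triangle.coyoneda_exact₁ _ hT f (((hP.copies n).vanish 1 le_rfl) _)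
      exact hc g
    · exact HomVanish.left hT (sub_add_cancel i 1) (hX.vanish _ (by lia))
        ((hP.copies n).vanish i (by lia))
  · exact finite_hom_mid k hT' ((finite_hom_shift k rfl).2 (hX.finite _)) ((hP.copies n).finite i)

end Approximation

section ProjectiveDimension

lemma pdLE_of_hasProjectiveDimensionLT {R : Type w} [Ring R] {n : ℕ} {M : ModuleCat.{w} R}
    (hM : HasProjectiveDimensionLT M (n + 1)) : pdLE R n M := by
  induction n generalizing M with
  | zero => exact projective_iff_hasProjectiveDimensionLT_one.2 hM
  | succ n ih =>
    let S := ShortComplex.mk (kernel.ι (Projective.π M)) (Projective.π M) (kernel.condition _)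
    have hS : S.ShortExact := { exact := ShortComplex.exact_kernel _ }
    exact ⟨_, Projective.π M, inferInstance, inferInstance,
      ih ((hS.hasProjectiveDimensionLT_X₃_iff n (inferInstanceAs (Projective (Projective.over M)))).1
        hM)⟩

variable {C : Type u} [Category.{w} C] [Preadditive C] {P : C}

/-- The module `Hom(P, X)` over the opposite endomorphism ring of `P`. -/
abbrev homModule (P X : C) : ModuleCat.{w} (End P)ᵐᵒᵖ := (preadditiveCoyonedaObj P).obj X

variable (P) in
/-- The map `Hom(P, X) ⟶ Hom(P, Y)` induced by postcomposition. -/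
abbrev homModuleMap {X Y : C} (f : X ⟶ Y) : homModule P X ⟶ homModule P Y :=
  (preadditiveCoyonedaObj P).map f

lemma isIso_homModuleMap_iff {X Y : C} (f : X ⟶ Y) :
    IsIso (homModuleMap P f) ↔
      (∀ g : P ⟶ X, g ≫ f = 0 → g = 0) ∧ ∀ g : P ⟶ Y, ∃ h : P ⟶ X, h ≫ f = g := by
  rw [ConcreteCategory.isIso_iff_bijective]
  exact and_congr (injective_iff_map_eq_zero (homModuleMap P f).hom) Iff.rfl

variable (P) in
lemma projective_homModule_self : Projective (homModule P P) := by
  let e : (End P)ᵐᵒᵖ ≃ₗ[(End P)ᵐᵒᵖ] (homModule P P) :=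
    { MulOpposite.opEquiv.symm with
      map_add' := fun _ _ => rfl
      map_smul' := fun _ _ => rfl }
  have : Module.Projective (End P)ᵐᵒᵖ (homModule P P) := Module.Projective.of_equiv e
  exact (IsProjective.iff_projective _).1 this

variable [HasFiniteBiproducts C]

variable (P) in
lemma projective_homModule_copies (n : ℕ) : Projective (homModule P (⨁ fun _ : Fin n => P)) := by
  have := projective_homModule_self P
  have : Projective (⨁ fun _ : Fin n => homModule P P) :=
    ⟨fun f e _ => ⟨biproduct.desc fun b => 
      Projective.factorThru (biproduct.ι (fun _ : Fin n => homModule P P) b ≫ f) e,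
      biproduct.hom_ext' _ _ fun _ => by simp⟩⟩
  exact Projective.of_iso ((preadditiveCoyonedaObj P).mapBiproduct fun _ : Fin n => P).symm this

end ProjectiveDimension

section TriangleDimension

variable {C : Type u} [Category.{w} C] [Preadditive C] [HasShift C ℤ]
  [∀ n : ℤ, (shiftFunctor C n).Additive] [HasZeroObject C] [Pretriangulated C] {P : C}

lemma hasProjectiveDimensionLT_of_distTriang {T : Triangle C} (hT : T ∈ distTriang C)
    (h₁ : HomVanish P T.obj₁ 1) (h₃ : HomVanish P T.obj₃ (-1)) (h₂ : Projective (homModule P T.obj₂))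
    {n : ℕ} (hn : HasProjectiveDimensionLT (homModule P T.obj₁) n) :
    HasProjectiveDimensionLT (homModule P T.obj₃) (n + 1) := by
  have hzero : homModuleMap P T.mor₁ ≫ homModuleMap P T.mor₂ = 0 := by
    rw [← CategoryTheory.Functor.map_comp, comp_distTriang_mor_zero₁₂ _ hT,
      CategoryTheory.Functor.map_zero]
  let S := ShortComplex.mk _ _ hzero
  have hS : S.ShortExact :=
    { exact := (ShortComplex.moduleCat_exact_iff _).2 fun x hx => by
        obtain ⟨y, hy⟩ := Triangle.coyoneda_exact₂ _ hT x hx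
        exact ⟨y, hy.symm⟩
      mono_f := (ModuleCat.mono_iff_injective _).2 <|
        (injective_iff_map_eq_zero (homModuleMap P T.mor₁).hom).2 fun x hx => by
          obtain ⟨y, rfl⟩ := Triangle.coyoneda_exact₂ _ (inv_rot_of_distTriang _ hT) x hx
          rw [h₃ y]
          exact zero_comp
      epi_g := (ModuleCat.epi_iff_surjective _).2 fun x => by
        obtain ⟨y, hy⟩ := Triangle.coyoneda_exact₃ _ hT x (h₁ _)
        exact ⟨y, hy.symm⟩ }
  have : Projective S.X₂ := h₂
  have : HasProjectiveDimensionLT S.X₂ (1 + n) := inferInstance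
  exact hS.hasProjectiveDimensionLT_X₃ n hn (add_comm n 1 ▸ this)

lemma isIso_homModuleMap_shift_mor₂ {T : Triangle C} (hT : T ∈ distTriang C) {i j : ℤ}
    (hij : i + 1 = j) (hi : HomVanish P T.obj₁ i) (hj : HomVanish P T.obj₁ j) :
    IsIso (homModuleMap P (T.mor₂⟦i⟧')) := by
  refine (isIso_homModuleMap_iff _).2 ⟨fun g hg => ?_, fun g => ?_⟩
  · obtain ⟨y, rfl⟩ := exists_lift_of_distTriang hT i g hg
    rw [hi y, zero_comp]
  · obtain ⟨y, hy⟩ := exists_lift_of_distTriang (rot_of_distTriang _ hT) i g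
      ((homVanish_shift (by lia)).2 hj _)
    exact ⟨y, hy.symm⟩

lemma isIso_homModuleMap_biprod_map {W X Y : C} (g : X ⟶ Y) [hg : IsIso (homModuleMap P g)] :
    IsIso (homModuleMap P (biprod.map (𝟙 W) g)) := by
  rw [isIso_homModuleMap_iff] at hg
  refine (isIso_homModuleMap_iff _).2 ⟨fun f hf => biprod.hom_ext _ _ ?_ ?_, fun f => ?_⟩
  · simpa using hf =≫ biprod.fst
  · rw [zero_comp]
    exact hg.1 _ (by simpa using hf =≫ biprod.snd)
  · obtain ⟨h, hh⟩ := hg.2 (f ≫ biprod.snd)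
    exact ⟨biprod.lift (f ≫ biprod.fst) h, by apply biprod.hom_ext <;> simp [hh]⟩

lemma hasProjectiveDimensionLT_of_isIso {X T Y : C} (φ : X ⟶ T ⊞ Y)
    [IsIso (homModuleMap P φ)] {n : ℕ} (hT : HasProjectiveDimensionLT (homModule P T) n)
    (hY : HasProjectiveDimensionLT (homModule P Y) n) :
    HasProjectiveDimensionLT (homModule P X) n :=
  have := preservesBinaryBiproducts_of_preservesBiproducts (preadditiveCoyonedaObj P)
  hasProjectiveDimensionLT_of_iso
    (asIso (homModuleMap P φ) ≪≫ (preadditiveCoyonedaObj P).mapBiprod T Y).symm n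

end TriangleDimension

section Hereditary

open Triangulated

variable {C : Type u} [Category.{w} C] [Preadditive C] [HasShift C ℤ]
  [∀ n : ℤ, (shiftFunctor C n).Additive] [HasZeroObject C] [Pretriangulated C]
  {k : Type} [Field k] [Linear k C] {P : C} {t : TStructure C}

variable (k t P) in
/-- An abstraction of the properties of a two-term silting complex `P` over a hereditary finite
dimensional algebra, with respect to the standard t-structure `t`. -/
structure IsHereditarySilting : Prop where
  connective : IsConnective k P P
  isLE_of_isConnective : ∀ X : C, IsConnective k P X → t.IsLE X 0
  eq_zero_of_isLE : ∀ Z : C, t.IsLE Z (-2) → ∀ f : P ⟶ Z, f = 0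
  hereditary : ∀ N Z : C, t.IsLE N 0 → t.IsGE N 0 → t.IsLE Z (-2) → ∀ f : N ⟶ Z, f = 0

namespace IsHereditarySilting

variable (h : IsHereditarySilting k P t)
include h

lemma homVanish_of_isGE (X : C) {n i : ℤ} (hi : i < n) [t.IsGE X n] : HomVanish P X i := fun f =>
  have := h.isLE_of_isConnective P h.connective
  have := t.isGE_shift X n i (n - i) (by lia)
  t.zero f 0 (n - i) (by lia)

lemma homVanish_of_isLE (X : C) {n i : ℤ} (hi : n + 2 ≤ i) [t.IsLE X n] : HomVanish P X i :=
  h.eq_zero_of_isLE _ (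
    have := t.isLE_shift X n i (n - i) (by lia)
    t.isLE_of_le _ (n - i) (-2) (by lia))

lemma homVanish_of_heart (N X : C) {n i : ℤ} (hi : n + 2 ≤ i) [t.IsLE N 0] [t.IsGE N 0]
    [t.IsLE X n] : HomVanish N X i :=
  h.hereditary _ _ inferInstance inferInstance (
    have := t.isLE_shift X n i (n - i) (by lia)
    t.isLE_of_le _ (n - i) (-2) (by lia))

lemma isLE_copies (n : ℕ) : t.IsLE (copies P n) 0 :=
  h.isLE_of_isConnective _ (h.connective.copies n)

lemma hasProjectiveDimensionLT_two (T : C) [t.IsLE T 0] [t.IsGE T 0] (hT : IsConnective k P T) :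
    HasProjectiveDimensionLT (homModule P T) 2 := by
  obtain ⟨n, T', a, b, c, hd, hT'⟩ := h.connective.exists_approximation hT
  obtain ⟨n', T'', a', b', c', hd', hT''⟩ := h.connective.exists_approximation hT'
  have := h.isLE_of_isConnective T'' hT''
  have hc' : c' = 0 := eq_zero_of_distTriang (inv_rot_of_distTriang _ hd)
    ((homVanish_shift_shift (by lia : (2 : ℤ) + -1 = 1)).2
      (h.homVanish_of_heart T T'' (n := 0) (by lia)))
    ((hT''.vanish 1 le_rfl).from_copies n) c'
  obtain ⟨s, hs⟩ := Triangle.coyoneda_exact₃ _ hd' (𝟙 T') (show 𝟙 T' ≫ c' = 0 by simp [hc'])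
  let r : Retract T' (copies P n') := { i := s, r := b', retract := hs.symm }
  have := projective_homModule_copies P n'
  exact hasProjectiveDimensionLT_of_distTriang hd (hT'.vanish 1 le_rfl)
    (h.homVanish_of_isGE T (n := 0) (by lia)) (projective_homModule_copies P n)
    ((r.map (preadditiveCoyonedaObj P)).hasProjectiveDimensionLT 1)

lemma exists_torsionFree (W : C) [t.IsLE W 0] (hW : IsConnective k P (W⟦(1 : ℤ)⟧)) :
    ∃ (F : C) (γ : W ⟶ F), t.IsLE F 0 ∧ t.IsGE F 0 ∧ (∀ f : P ⟶ F, f = 0) ∧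
      IsConnective k P (F⟦(1 : ℤ)⟧) ∧ IsIso (homModuleMap P (γ⟦(1 : ℤ)⟧')) := by
  have := (finite_hom_zero k).1 ((finite_hom_shift k (by lia : (1 : ℤ) + -1 = 0)).1 (hW.finite (-1)))
  obtain ⟨n, f, hf⟩ := exists_copies_hom k (P := P) W
  have hE := h.connective.copies n
  have := h.isLE_copies n
  obtain ⟨Y, b, c, hd⟩ := distinguished_cocone_triangle f
  obtain ⟨D, F, hD, hF, i, p, δ, hd'⟩ := t.exists_triangle Y (-1) 0 (by lia)
  have : t.IsLE D (-1) := ⟨hD⟩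
  have : t.IsGE F 0 := ⟨hF⟩
  have : t.IsLE Y 0 := t.isLE₂ _ (rot_of_distTriang _ hd) 0 ‹_›
    (have := t.isLE_shift (copies P n) 0 1 (-1) (by lia); t.isLE_of_le ((copies P n)⟦(1 : ℤ)⟧) (-1) 0 (by lia))
  have hFLE : t.IsLE F 0 := t.isLE₂ _ (rot_of_distTriang _ hd') 0 ‹_›
    (have := t.isLE_shift D (-1) 1 (-2) (by lia); t.isLE_of_le (D⟦(1 : ℤ)⟧) (-2) 0 (by lia))
  have hPF : ∀ g : P ⟶ F, g = 0 := fun g => by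
    obtain ⟨g, rfl⟩ := Triangle.coyoneda_exact₃ _ hd' g
      (h.homVanish_of_isLE D (n := -1) (by lia) _)
    obtain ⟨g, rfl⟩ := Triangle.coyoneda_exact₃ _ hd g (hE.vanish 1 le_rfl _)
    obtain ⟨g, rfl⟩ := hf g
    have hfb : f ≫ b = 0 := comp_distTriang_mor_zero₁₂ _ hd
    change ((g ≫ f) ≫ b) ≫ p = 0
    rw [Category.assoc g, hfb, comp_zero, zero_comp]
  have h₁ : IsIso (homModuleMap P (b⟦(1 : ℤ)⟧')) :=
    isIso_homModuleMap_shift_mor₂ hd (by lia : (1 : ℤ) + 1 = 2) (hE.vanish 1 le_rfl)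
      (hE.vanish 2 (by lia))
  have h₂ : IsIso (homModuleMap P (p⟦(1 : ℤ)⟧')) :=
    isIso_homModuleMap_shift_mor₂ hd' (by lia : (1 : ℤ) + 1 = 2)
      (h.homVanish_of_isLE D (n := -1) (by lia)) (h.homVanish_of_isLE D (n := -1) (by lia))
  have h₃ : IsIso (homModuleMap P ((b ≫ p)⟦(1 : ℤ)⟧')) := by
    rw [CategoryTheory.Functor.map_comp, homModuleMap, CategoryTheory.Functor.map_comp]
    infer_instance
  refine ⟨F, b ≫ p, hFLE, ‹_›, hPF, ⟨fun i hi => (homVanish_shift rfl).2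
    (h.homVanish_of_isLE F (n := 0) (by lia)), fun i => ?_⟩, h₃⟩
  obtain hi | rfl | rfl | hi : i < -1 ∨ i = -1 ∨ i = 0 ∨ 0 < i := by lia
  · exact HomVanish.finite k ((homVanish_shift rfl).2 (h.homVanish_of_isGE F (n := 0) (by lia)))
  · exact HomVanish.finite k ((homVanish_shift (by lia)).2 (homVanish_zero_iff.2 hPF))
  · have := (finite_hom_zero k).1 (hW.finite 0)
    exact (finite_hom_zero k).2 (Module.Finite.of_surjective
      (Linear.rightComp k P ((b ≫ p)⟦(1 : ℤ)⟧')) ((isIso_homModuleMap_iff _).1 h₃).2)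
  · exact HomVanish.finite k ((homVanish_shift rfl).2 (h.homVanish_of_isLE F (n := 0) (by lia)))

lemma exists_torsion_pair {X : C} (hX : IsConnective k P X) :
    ∃ (T F : C) (φ : X ⟶ T ⊞ F⟦(1 : ℤ)⟧), t.IsLE T 0 ∧ t.IsGE T 0 ∧ IsConnective k P T ∧
      t.IsLE F 0 ∧ t.IsGE F 0 ∧ (∀ f : P ⟶ F, f = 0) ∧
      IsConnective k P (F⟦(1 : ℤ)⟧) ∧ IsIso (homModuleMap P φ) := by
  have := h.isLE_of_isConnective X hX
  obtain ⟨Z, T, hZ, hT, i, p, δ, hd⟩ := t.exists_triangle X (-1) 0 (by lia)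
  have : t.IsLE Z (-1) := ⟨hZ⟩
  have : t.IsGE T 0 := ⟨hT⟩
  have hTLE : t.IsLE T 0 := t.isLE₂ _ (rot_of_distTriang _ hd) 0 ‹_›
    (have := t.isLE_shift Z (-1) 1 (-2) (by lia); t.isLE_of_le (Z⟦(1 : ℤ)⟧) (-2) 0 (by lia))
  obtain ⟨e, -, -⟩ := exists_iso_binaryBiproduct_of_distTriang _ hd
    (h.homVanish_of_heart T Z (n := -1) (by lia) _)
  change X ≅ Z ⊞ T at e
  have hT' : IsConnective k P T := hX.of_retract
    { i := biprod.inr ≫ e.inv, r := e.hom ≫ biprod.snd }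
  have hZ' : IsConnective k P Z := hX.of_retract
    { i := biprod.inl ≫ e.inv, r := e.hom ≫ biprod.fst }
  let θ : Z⟦(-1 : ℤ)⟧⟦(1 : ℤ)⟧ ≅ Z := shiftNegShift Z 1
  have := t.isLE_shift Z (-1) (-1) 0 (by lia)
  obtain ⟨F, γ, hF₁, hF₂, hF₃, hF₄, hγ⟩ :=
    h.exists_torsionFree (Z⟦(-1 : ℤ)⟧) (hZ'.of_retract θ.retract)
  refine ⟨T, F, e.hom ≫ (biprod.braiding Z T).hom ≫ biprod.map (𝟙 T) (θ.inv ≫ γ⟦(1 : ℤ)⟧'),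
    hTLE, ‹_›, hT', hF₁, hF₂, hF₃, hF₄, ?_⟩
  have : IsIso (homModuleMap P (θ.inv ≫ γ⟦(1 : ℤ)⟧')) := by
    rw [homModuleMap, CategoryTheory.Functor.map_comp]
    infer_instance
  have := isIso_homModuleMap_biprod_map (P := P) (W := T) (θ.inv ≫ γ⟦(1 : ℤ)⟧')
  rw [homModuleMap, CategoryTheory.Functor.map_comp, CategoryTheory.Functor.map_comp]
  infer_instance

lemma hasProjectiveDimensionLT_four_of_torsionFree (F : C) [t.IsLE F 0] [t.IsGE F 0]
    (hF : ∀ f : P ⟶ F, f = 0) (hX : IsConnective k P (F⟦(1 : ℤ)⟧)) :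
    HasProjectiveDimensionLT (homModule P (F⟦(1 : ℤ)⟧)) 4 := by
  obtain ⟨n, K, a, b, c, hd, hK⟩ := h.connective.exists_approximation hX
  refine hasProjectiveDimensionLT_of_distTriang hd (hK.vanish 1 le_rfl)
    ((homVanish_shift (by lia)).2 (homVanish_zero_iff.2 hF)) (projective_homModule_copies P n) ?_
  have := hK.finite (-1)
  obtain ⟨m, f, hf⟩ := exists_copies_hom k (P := P) (K⟦(-1 : ℤ)⟧)
  have hE := h.connective.copies m
  obtain ⟨Y, p, q, hd'⟩ := distinguished_cocone_triangle f
  have hY : ∀ g : P ⟶ Y, g = 0 := fun g => by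
    obtain ⟨g, rfl⟩ := Triangle.coyoneda_exact₃ _ hd' g (hE.vanish 1 le_rfl _)
    obtain ⟨g, rfl⟩ := hf g
    have hfp : f ≫ p = 0 := comp_distTriang_mor_zero₁₂ _ hd'
    change (g ≫ f) ≫ p = 0
    rw [Category.assoc, hfp, comp_zero]
  let θ : K⟦(-1 : ℤ)⟧⟦(1 : ℤ)⟧ ≅ K := shiftNegShift K 1
  have hY' : IsConnective k P (Y⟦(1 : ℤ)⟧) :=
    IsConnective.right (Triangle.shift_distinguished _ hd' 1) (hE.shift zero_le_one)
      (hK.of_retract θ.retract)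
  have hp : IsIso (homModuleMap P (p⟦(1 : ℤ)⟧')) :=
    isIso_homModuleMap_shift_mor₂ hd' (by lia : (1 : ℤ) + 1 = 2) (hE.vanish 1 le_rfl)
      (hE.vanish 2 (by lia))
  suffices HasProjectiveDimensionLT (homModule P (Y⟦(1 : ℤ)⟧)) 3 from
    hasProjectiveDimensionLT_of_iso ((preadditiveCoyonedaObj P).mapIso θ.symm ≪≫
      asIso (homModuleMap P (p⟦(1 : ℤ)⟧'))).symm 3
  obtain ⟨l, L, a₁, b₁, c₁, hd₁, hL⟩ := h.connective.exists_approximation hY'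
  refine hasProjectiveDimensionLT_of_distTriang hd₁ (hL.vanish 1 le_rfl)
    ((homVanish_shift (by lia)).2 (homVanish_zero_iff.2 hY)) (projective_homModule_copies P l) ?_
  obtain ⟨T, G, φ, _, _, hT, _, _, hG, -, _⟩ := h.exists_torsion_pair hL
  refine hasProjectiveDimensionLT_of_isIso φ (h.hasProjectiveDimensionLT_two T hT) ?_
  have hKG : HomVanish K G 2 := eq_zero_of_distTriang (inv_rot_of_distTriang _ hd)
    ((homVanish_shift_shift (by lia : (3 : ℤ) + -1 = 2)).2
      ((homVanish_shift_shift (by lia : (2 : ℤ) + 1 = 3)).2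
        (h.homVanish_of_heart F G (n := 0) (by lia))))
    ((h.homVanish_of_isLE G (n := 0) (by lia)).from_copies n)
  have hYG : HomVanish Y G 1 := eq_zero_of_distTriang (rot_of_distTriang _ hd')
    ((homVanish_shift_shift (by lia : (2 : ℤ) + -1 = 1)).2 hKG)
    ((homVanish_shift_shift (by lia : (0 : ℤ) + 1 = 1)).2
      ((homVanish_zero_iff.2 hG).from_copies m))
  obtain ⟨(γ : copies P l ⟶ _), hγ⟩ := Triangle.yoneda_exact₂ _ (inv_rot_of_distTriang _ hd₁) (φ ≫ biprod.snd)
    ((homVanish_shift_shift (by lia : (2 : ℤ) + -1 = 1)).2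
      ((homVanish_shift_shift (by lia : (1 : ℤ) + 1 = 2)).2 hYG) _)
  change φ ≫ biprod.snd = a₁ ≫ γ at hγ
  let r : Retract (homModule P (G⟦(1 : ℤ)⟧)) (homModule P (copies P l)) :=
    { i := homModuleMap P biprod.inr ≫ inv (homModuleMap P φ) ≫ homModuleMap P a₁
      r := homModuleMap P γ
      retract := by
        rw [Category.assoc, Category.assoc, ← CategoryTheory.Functor.map_comp, ← hγ,
          CategoryTheory.Functor.map_comp, IsIso.inv_hom_id_assoc,
          ← CategoryTheory.Functor.map_comp, biprod.inr_snd, CategoryTheory.Functor.map_id] }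
  have := projective_homModule_copies P l
  have := r.hasProjectiveDimensionLT 1
  exact hasProjectiveDimensionLT_of_ge _ 1 2 (by lia)

lemma hasProjectiveDimensionLT_four {X : C} (hX : IsConnective k P X) :
    HasProjectiveDimensionLT (homModule P X) 4 := by
  obtain ⟨T, F, φ, _, _, hT, _, _, hF, hF', _⟩ := h.exists_torsion_pair hX
  have := h.hasProjectiveDimensionLT_two T hT
  exact hasProjectiveDimensionLT_of_isIso φ (hasProjectiveDimensionLT_of_ge _ 2 4 (by lia))
    (h.hasProjectiveDimensionLT_four_of_torsionFree F hF hF')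

end IsHereditarySilting

end Hereditary

section Realization

variable {C : Type u} [Category.{w} C] [Preadditive C] {P : C}

variable (P) in
/-- The module of morphisms from `P` to a sum of copies of `P` is free. -/
def homModuleBiproductEquiv [HasFiniteBiproducts C] (n : ℕ) :
    homModule P (⨁ fun _ : Fin n => P) ≃ₗ[(End P)ᵐᵒᵖ] (Fin n → (End P)ᵐᵒᵖ) where
  toFun (φ : P ⟶ ⨁ fun _ : Fin n => P) i :=
    MulOpposite.op (φ ≫ biproduct.π (fun _ : Fin n => P) i : P ⟶ P)
  invFun b := (biproduct.lift fun i => (b i).unop : P ⟶ ⨁ fun _ : Fin n => P)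
  map_add' φ ψ := funext fun _ => congr_arg MulOpposite.op (Preadditive.add_comp _ _ _ φ ψ _)
  map_smul' b φ := funext fun _ => congr_arg MulOpposite.op (Category.assoc b.unop φ _)
  left_inv _ := biproduct.hom_ext _ _ fun _ => biproduct.lift_π _ _
  right_inv _ := funext fun _ => congr_arg MulOpposite.op (biproduct.lift_π _ _)

variable [HasShift C ℤ] [∀ n : ℤ, (shiftFunctor C n).Additive] [HasZeroObject C] [Pretriangulated C]
  {k : Type} [Field k] [Linear k C]

lemma IsConnective.exists_homModule_iso (hP : IsConnective k P P) (M : ModuleCat.{w} (End P)ᵐᵒᵖ)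
    [Module.Finite (End P)ᵐᵒᵖ M] :
    ∃ X : C, IsConnective k P X ∧ Nonempty (homModule P X ≅ M) := by
  have : Module.Finite k (End P) := (finite_hom_zero k).1 (hP.finite 0)
  have : IsNoetherianRing (End P)ᵐᵒᵖ := IsNoetherianRing.of_finite k _
  obtain ⟨n, q, hq⟩ := Module.Finite.exists_fin' (End P)ᵐᵒᵖ M
  let e := homModuleBiproductEquiv P n
  let π := q ∘ₗ e.toLinearMap
  have hπ : Function.Surjective π := hq.comp e.surjective
  have : Module.Finite (End P)ᵐᵒᵖ (homModule P (⨁ fun _ : Fin n => P)) :=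
    Module.Finite.equiv e.symm
  obtain ⟨m, s, hs⟩ := Submodule.fg_iff_exists_fin_generating_family.1
    (IsNoetherian.noetherian (LinearMap.ker π))
  let s' : Fin m → (P ⟶ TwoTermSilting.copies P n) := s
  let f : TwoTermSilting.copies P m ⟶ TwoTermSilting.copies P n := biproduct.desc s'
  obtain ⟨X, g, δ, hT⟩ := distinguished_cocone_triangle f
  have hgf : f ≫ g = 0 := comp_distTriang_mor_zero₁₂ _ hT
  refine ⟨X, IsConnective.right hT (hP.copies m) (hP.copies n), ⟨?_⟩⟩
  have hsurj : Function.Surjective (homModuleMap P g).hom := fun x => by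
    obtain ⟨y, hy⟩ := Triangle.coyoneda_exact₃ _ hT x ((hP.copies m).vanish 1 le_rfl _)
    exact ⟨y, hy.symm⟩
  have hker : LinearMap.ker (homModuleMap P g).hom = LinearMap.ker π := by
    refine le_antisymm (fun x hx => ?_) ?_
    · obtain ⟨y, rfl⟩ := Triangle.coyoneda_exact₂ _ hT x hx
      have hy (y : P ⟶ TwoTermSilting.copies P m) :
          y ≫ f = ∑ i, (y ≫ biproduct.π (fun _ : Fin m => P) i) ≫ s' i := by
        have hf : f = ∑ i, biproduct.π (fun _ : Fin m => P) i ≫ s' i := biproduct.desc_eq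
        simp only [hf, Preadditive.comp_sum, Category.assoc]
      rw [← hs]
      exact (Submodule.mem_span_range_iff_exists_fun _).2 
        ⟨homModuleBiproductEquiv P m y, (hy y).symm⟩
    · rw [← hs, Submodule.span_le]
      rintro _ ⟨i, rfl⟩
      change s' i ≫ g = 0
      have : biproduct.ι (fun _ : Fin m => P) i ≫ f = s' i := biproduct.ι_desc _ _
      rw [← this, Category.assoc, hgf, comp_zero]
  exact ((LinearMap.quotKerEquivOfSurjective _ hsurj).symm ≪≫ₗ
    Submodule.quotEquivOfEq _ _ hker ≪≫ₗ LinearMap.quotKerEquivOfSurjective π hπ).toModuleIso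

lemma IsHereditarySilting.gldLE_three {t : Triangulated.TStructure C}
    (h : IsHereditarySilting k P t) : gldLE.{w, w} (End P)ᵐᵒᵖ 3 := by
  intro M _
  obtain ⟨X, hX, ⟨e⟩⟩ := h.connective.exists_homModule_iso M
  have := h.hasProjectiveDimensionLT_four hX
  exact pdLE_of_hasProjectiveDimensionLT (hasProjectiveDimensionLT_of_iso e 4)

end Realization

section HereditaryRing

variable {R : Type} [Ring R]

lemma hasProjectiveDimensionLT_two_of_pdLE_one {M : ModuleCat.{0} R} (hM : pdLE R 1 M) :
    HasProjectiveDimensionLT M 2 := by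
  obtain ⟨Q, f, hQ, hf, hK⟩ := hM
  let S := ShortComplex.mk (kernel.ι f) f (kernel.condition _)
  have hS : S.ShortExact := { exact := ShortComplex.exact_kernel _ }
  exact (hS.hasProjectiveDimensionLT_X₃_iff 0 hQ).2
    (projective_iff_hasProjectiveDimensionLT_one.1 hK)

lemma projective_ideal (hR : gldLE.{0, 0} R 1) (I : Ideal R) : Module.Projective R I := by
  let S := ShortComplex.moduleCatMk I.subtype I.mkQ (by ext; simp)
  have hS : S.ShortExact :=
    { exact := (ShortComplex.moduleCat_exact_iff _).2 fun x hx =>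
        ⟨⟨x, (Submodule.Quotient.mk_eq_zero I).1 hx⟩, rfl⟩
      mono_f := (ModuleCat.mono_iff_injective _).2 I.subtype_injective
      epi_g := (ModuleCat.epi_iff_surjective _).2 I.mkQ_surjective }
  have hX₂ : Projective S.X₂ := (IsProjective.iff_projective (R := R) R).1 inferInstance
  have := (hS.hasProjectiveDimensionLT_X₃_iff 0 hX₂).1
    (hasProjectiveDimensionLT_two_of_pdLE_one (hR _ (inferInstanceAs (Module.Finite R (R ⧸ I)))))
  have : Projective (ModuleCat.of R I) := projective_iff_hasProjectiveDimensionLT_one.2 this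
  exact (IsProjective.iff_projective (R := R) I).2 this

lemma injective_of_epi (hR : gldLE.{0, 0} R 1) {E Y : ModuleCat.{0} R} [Injective E]
    (p : E ⟶ Y) [Epi p] : Injective Y := by
  have hE : Module.Baer R E := Module.Baer.of_injective (Module.injective_module_of_injective_object R E)
  suffices Module.Baer R Y from
    have := this.injective
    Module.injective_object_of_injective_module R Y
  intro I g
  have := projective_ideal hR I
  obtain ⟨g', rfl⟩ := Module.projective_lifting_property p.hom g
    ((ModuleCat.epi_iff_surjective p).1 inferInstance)
  obtain ⟨e, he⟩ := hE I g'
  exact ⟨p.hom ∘ₗ e, fun x hx => congr_arg p.hom (he x hx)⟩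

lemma hasProjectiveDimensionLT_two (hR : gldLE.{0, 0} R 1) (M : ModuleCat.{0} R) :
    HasProjectiveDimensionLT M 2 := by
  have hinj (Y : ModuleCat.{0} R) : HasInjectiveDimensionLT Y 2 := by
    let S := ShortComplex.mk (Injective.ι Y) (cokernel.π (Injective.ι Y)) (cokernel.condition _)
    have hS : S.ShortExact := { exact := ShortComplex.exact_cokernel _ }
    have hX₂ : Injective S.X₂ := inferInstanceAs (Injective (Injective.under Y))
    have hX₃ : Injective S.X₃ := injective_of_epi hR (cokernel.π (Injective.ι Y))
    exact (hS.hasInjectiveDimensionLT_X₃_iff 0 hX₂).1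
      (injective_iff_hasInjectiveDimensionLT_one.1 hX₃)
  let := HasExt.standard (ModuleCat.{0} R)
  rw [hasProjectiveDimensionLT_iff]
  intro i hi Y e
  exact Abelian.Ext.eq_zero_of_hasInjectiveDimensionLT e 2 hi

lemma exists_projective_presentation (hR : gldLE.{0, 0} R 1) (M : ModuleCat.{0} R) :
    ∃ S : ShortComplex (ModuleCat.{0} R), S.ShortExact ∧ Projective S.X₁ ∧ Projective S.X₂ ∧
      S.X₃ = M := by
  let S := ShortComplex.mk (kernel.ι (Projective.π M)) (Projective.π M) (kernel.condition _)
  have hS : S.ShortExact := { exact := ShortComplex.exact_kernel _ }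
  have hX₂ : Projective S.X₂ := inferInstanceAs (Projective (Projective.over M))
  exact ⟨S, hS, projective_iff_hasProjectiveDimensionLT_one.2
    ((hS.hasProjectiveDimensionLT_X₃_iff 0 hX₂).1 (hasProjectiveDimensionLT_two hR M)), hX₂, rfl⟩

end HereditaryRing

section DerivedHom

open DerivedCategory

variable {C : Type u} [Category.{v} C] [Abelian C] [HasDerivedCategory.{w} C]

lemma Q_map_surjective_of_isKProjective (K L : CochainComplex C ℤ) [K.IsKProjective]
    (f : Q.obj K ⟶ Q.obj L) : ∃ g : K ⟶ L, Q.map g = f := by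
  obtain ⟨h, hh⟩ := (CochainComplex.IsKProjective.Qh_map_bijective K
    ((HomotopyCategory.quotient C _).obj L)).2
      ((quotientCompQhIso C).hom.app K ≫ f ≫ (quotientCompQhIso C).inv.app L)
  obtain ⟨g, rfl⟩ := (HomotopyCategory.quotient C _).map_surjective h
  refine ⟨g, ?_⟩
  rw [← cancel_epi ((quotientCompQhIso C).hom.app K), ← quotientCompQhIso_hom_naturality, hh]
  simp

lemma nonempty_homotopy_zero_of_isKProjective {K L : CochainComplex C ℤ} [K.IsKProjective]
    {f : K ⟶ L} (hf : (Q (C := C)).map f = 0) : Nonempty (Homotopy f 0) := by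
  refine (HomotopyCategory.quotient_map_eq_zero_iff f).1
    ((CochainComplex.IsKProjective.Qh_map_bijective K _).1 ?_)
  rw [CategoryTheory.Functor.map_zero, ← cancel_mono ((quotientCompQhIso C).hom.app L),
    quotientCompQhIso_hom_naturality, hf, comp_zero, zero_comp]

lemma hom_eq_zero_of_isLE_of_isStrictlyGE {K : CochainComplex C ℤ} {m n : ℤ} (hmn : m < n)
    [K.IsKProjective] [K.IsStrictlyGE n] {Z : DerivedCategory C} [hZ : Z.IsLE m]
    (f : Q.obj K ⟶ Z) : f = 0 := by
  obtain ⟨L, _, ⟨e⟩⟩ := Z.exists_iso_Q_obj_of_isLE m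
  obtain ⟨g, hg⟩ := Q_map_surjective_of_isKProjective K L (f ≫ e.hom)
  have : g = 0 := by
    ext i
    obtain hi | hi := lt_or_ge i n
    · exact (K.isZero_of_isStrictlyGE n i hi).eq_of_src _ _
    · exact (L.isZero_of_isStrictlyLE m i (by lia)).eq_of_tgt _ _
  rw [← cancel_mono e.hom, ← hg, this, CategoryTheory.Functor.map_zero, zero_comp]

instance (X : C) [Projective X] (n i : ℤ) :
    Projective (((HomologicalComplex.single C (ComplexShape.up ℤ) n).obj X).X i) := by
  by_cases h : i = n
  · exact Projective.of_iso (HomologicalComplex.singleObjXIsoOfEq _ n X i h).symm inferInstance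
  · exact (HomologicalComplex.isZero_single_obj_X _ n X i h).projective

instance (X : C) [Projective X] (n : ℤ) :
    CochainComplex.IsKProjective ((HomologicalComplex.single C (ComplexShape.up ℤ) n).obj X) :=
  have : CochainComplex.IsStrictlyLE ((HomologicalComplex.single C (ComplexShape.up ℤ) n).obj X) n :=
    inferInstanceAs (((CochainComplex.singleFunctor C n).obj X).IsStrictlyLE n)
  CochainComplex.isKProjective_of_projective _ n

lemma homVanish_single_of_isLE {X : C} [Projective X] {Z : DerivedCategory C} {m i : ℤ}
    (hm : m < i) [Z.IsLE m] : HomVanish ((singleFunctor C 0).obj X) Z i := fun f =>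
  have := TStructure.t.isLE_shift Z m i (m - i) (by lia)
  have : CochainComplex.IsStrictlyGE ((HomologicalComplex.single C (ComplexShape.up ℤ) 0).obj X) 0 :=
    inferInstanceAs (((CochainComplex.singleFunctor C 0).obj X).IsStrictlyGE 0)
  hom_eq_zero_of_isLE_of_isStrictlyGE
    (K := (HomologicalComplex.single C (ComplexShape.up ℤ) 0).obj X) (by lia : m - i < 0) f

lemma homVanish_single_iff {X : C} {Z : DerivedCategory C} (n : ℤ) :
    HomVanish ((singleFunctor C n).obj X) Z 0 ↔ HomVanish ((singleFunctor C 0).obj X) Z n := by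
  rw [← homVanish_shift_shift (by lia : n + -n = 0)]
  let e : ((singleFunctor C 0).obj X)⟦-n⟧ ≅ (singleFunctor C n).obj X :=
    ((singleFunctors C).shiftIso (-n) n 0 (by lia)).app X
  exact ⟨fun h f => by rw [← cancel_epi e.inv, comp_zero, h (e.inv ≫ f)],
    fun h f => by rw [← cancel_epi e.hom, comp_zero, h (e.hom ≫ f)]⟩

lemma homVanish_singleFunctor_of_shortExact {S : ShortComplex C} (hS : S.ShortExact)
    [Projective S.X₁] [Projective S.X₂] {Z : DerivedCategory C} [Z.IsLE (-2)] :
    HomVanish ((singleFunctor C 0).obj S.X₃) Z 0 := fun f =>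
  eq_zero_of_distTriang (rot_of_distTriang _ hS.singleTriangle_distinguished)
    (homVanish_single_of_isLE (by lia : (-2 : ℤ) < 0))
    ((homVanish_shift_shift (by lia : (-1 : ℤ) + 1 = 0)).2
      (homVanish_single_of_isLE (by lia : (-2 : ℤ) < -1))) f

end DerivedHom

section ModuleDerived

open DerivedCategory

variable {R : Type} [Ring R] [HasDerivedCategory.{w} (ModuleCat.{0} R)]

lemma exactAt_of_homVanish {K : CochainComplex (ModuleCat.{0} R) ℤ} {n : ℤ}
    (h : HomVanish ((singleFunctor (ModuleCat.{0} R) n).obj (ModuleCat.of R R)) (Q.obj K) 0) :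
    K.ExactAt n := by
  rw [HomologicalComplex.exactAt_iff' K (n - 1) n (n + 1) (by simp) (by simp),
    ShortComplex.moduleCat_exact_iff]
  intro (x : K.X n) (hx : K.d n (n + 1) x = 0)
  have : Projective (ModuleCat.of R R) := (IsProjective.iff_projective (R := R) R).1 inferInstance
  let φ : ModuleCat.of R R ⟶ K.X n := ModuleCat.ofHom (LinearMap.toSpanSingleton R _ x)
  let ψ := HomologicalComplex.mkHomFromSingle (c := ComplexShape.up ℤ) φ fun k hk => by
    obtain rfl : n + 1 = k := hk
    ext
    simpa [φ] using hx
  obtain ⟨H⟩ := nonempty_homotopy_zero_of_isKProjective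
    (K := (HomologicalComplex.single _ (ComplexShape.up ℤ) n).obj (ModuleCat.of R R))
    (homVanish_zero_iff.1 h (Q.map ψ))
  have hφ : φ = ((HomologicalComplex.singleObjXSelf (ComplexShape.up ℤ) n (ModuleCat.of R R)).inv ≫
      H.hom n (n - 1)) ≫ K.d (n - 1) n := by
    have := H.comm n
    rw [dNext_eq H.hom (show (ComplexShape.up ℤ).Rel n (n + 1) from rfl),
      prevD_eq H.hom (show (ComplexShape.up ℤ).Rel (n - 1) n from sub_add_cancel n 1),
      HomologicalComplex.single_obj_d, zero_comp, zero_add, HomologicalComplex.zero_f, add_zero,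
      HomologicalComplex.mkHomFromSingle_f, ← Iso.eq_inv_comp] at this
    rw [this, Category.assoc]
  have hx' : φ.hom (1 : R) = x := LinearMap.toSpanSingleton_apply_one R _ x
  rw [hφ] at hx'
  exact ⟨_, hx'⟩

end ModuleDerived

section Thick

variable {C : Type u} [Category.{w} C] [Preadditive C] [HasShift C ℤ]
  [∀ n : ℤ, (shiftFunctor C n).Additive] [HasZeroObject C] [Pretriangulated C]

lemma isThick_eventually_homVanish (V : Set C) :
    IsThick {W : C | ∃ N : ℤ, ∀ n ≥ N, ∀ X ∈ V, HomVanish W X n} := by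
  refine ⟨fun W W' e ⟨N, hN⟩ => ⟨N, fun n hn X hX f => ?_⟩,
    fun W a ⟨N, hN⟩ => ⟨N + a, fun n hn X hX =>
      (homVanish_shift_shift (sub_add_cancel n a)).2 (hN _ (by lia) X hX)⟩,
    fun T hT ⟨N₁, h₁⟩ ⟨N₃, h₃⟩ => ⟨max N₁ N₃, fun n hn X hX => eq_zero_of_distTriang hT
      (h₁ n (le_trans (le_max_left _ _) hn) X hX) (h₃ n (le_trans (le_max_right _ _) hn) X hX)⟩,
    fun W W' ι r h ⟨N, hN⟩ => ⟨N, fun n hn X hX f => ?_⟩⟩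
  · rw [← cancel_epi e.hom, comp_zero, hN n hn X hX (e.hom ≫ f)]
  · rw [← Category.id_comp f, ← h, Category.assoc, hN n hn X hX (r ≫ f), comp_zero]

lemma homVanish_of_eventually {k : Type} [Field k] [Linear k C] {P W : C}
    (hP : IsConnective k P P) (hW : ∀ i : ℤ, 1 ≤ i → HomVanish W P i)
    (hN : ∃ N : ℤ, ∀ n ≥ N, ∀ X : C, IsConnective k P X → HomVanish W X n) {X : C}
    (hX : IsConnective k P X) {i : ℤ} (hi : 1 ≤ i) : HomVanish W X i := by
  obtain ⟨N, hN⟩ := hN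
  obtain ⟨d, hd⟩ : ∃ d : ℕ, N ≤ i + d := ⟨(N - i).toNat, by lia⟩
  induction d generalizing X i with
  | zero => exact hN i (by simpa using hd) X hX
  | succ d ih =>
    obtain ⟨n, K, a, b, c, hT, hK⟩ := hP.exists_approximation hX
    exact HomVanish.mid (rot_of_distTriang _ hT) ((hW i hi).to_copies n)
      ((homVanish_shift (add_comm 1 i)).2 (ih hK (by lia) (by push_cast at hd; lia)))

end Thick

section Concrete

open DerivedCategory

variable {R : Type} [Ring R]

lemma isPerfCplx_single : IsPerfCplx R
    ((HomologicalComplex.single (ModuleCat.{0} R) (ComplexShape.up ℤ) 0).obj (ModuleCat.of R R)) := by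
  have : Projective (ModuleCat.of R R) := (IsProjective.iff_projective (R := R) R).1 inferInstance
  refine ⟨inferInstance, fun i => ?_, 0, 0, fun i hi =>
    HomologicalComplex.isZero_single_obj_X _ _ _ _ (by lia)⟩
  by_cases hi : i = 0
  · exact Module.Finite.equiv
      (HomologicalComplex.singleObjXIsoOfEq (ComplexShape.up ℤ) 0 (ModuleCat.of R R) i hi).symm.toLinearEquiv
  · have := ModuleCat.subsingleton_of_isZero
      (HomologicalComplex.isZero_single_obj_X (ComplexShape.up ℤ) 0 (ModuleCat.of R R) i hi)
    infer_instance

lemma finite_moduleCat_hom {k : Type} [Field k] [Algebra k R] [FiniteDimensional k R] (M N : ModuleCat.{0} R) [Module.Finite R M]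
    [Module.Finite R N] : Module.Finite k (M ⟶ N) := by
  let := ModuleCat.moduleOfAlgebraModule (k := k) M
  let := ModuleCat.moduleOfAlgebraModule (k := k) N
  have := ModuleCat.isScalarTower_of_algebra_moduleCat (k := k) M
  have := ModuleCat.isScalarTower_of_algebra_moduleCat (k := k) N
  have : Module.Finite k M := Module.Finite.trans R M
  have : Module.Finite k N := Module.Finite.trans R N
  let φ : (M ⟶ N) →ₗ[k] (M →ₗ[k] N) :=
    { toFun f := f.hom.restrictScalars k
      map_add' _ _ := rfl
      map_smul' _ _ := rfl }
  exact Module.Finite.of_injective φ fun f g h => by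
    ext x
    exact LinearMap.congr_fun h x

namespace IsTwoTermCplx

variable {P : CochainComplex (ModuleCat.{0} R) ℤ} (hP : IsTwoTermCplx R P)
include hP

lemma isStrictlyLE : P.IsStrictlyLE 0 :=
  (P.isStrictlyLE_iff 0).2 fun i _ => hP.2.2 i (by lia) (by lia)

lemma isStrictlyGE : P.IsStrictlyGE (-1) :=
  (P.isStrictlyGE_iff (-1)).2 fun i _ => hP.2.2 i (by lia) (by lia)

lemma isKProjective : P.IsKProjective :=
  have := hP.1
  have := hP.isStrictlyLE
  CochainComplex.isKProjective_of_projective P 0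

end IsTwoTermCplx

variable [HasDerivedCategory.{w} (ModuleCat.{0} R)]

lemma isLE_zero_of_homVanish {X : DerivedCategory (ModuleCat.{0} R)}
    (h : ∀ i : ℤ, 1 ≤ i →
      HomVanish ((singleFunctor (ModuleCat.{0} R) 0).obj (ModuleCat.of R R)) X i) :
    X.IsLE 0 := by
  let e := Q.objObjPreimageIso X
  suffices (Q.objPreimage X).IsLE 0 from
    TStructure.t.isLE_of_iso e 0
  rw [CochainComplex.isLE_iff]
  intro i hi
  refine exactAt_of_homVanish ((homVanish_single_iff i).2 fun f => ?_)
  rw [← cancel_mono (e.hom⟦i⟧'), zero_comp, h i hi (f ≫ e.hom⟦i⟧')]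

variable {k : Type} [Field k] [Algebra k R]

namespace IsTwoTermCplx

variable {P : CochainComplex (ModuleCat.{0} R) ℤ} (hP : IsTwoTermCplx R P)
include hP

lemma isLE : (Q.obj P).IsLE 0 :=
  have := hP.isStrictlyLE
  inferInstance

lemma eq_zero_of_isLE {Z : DerivedCategory (ModuleCat.{0} R)} (hZ : Z.IsLE (-2))
    (f : Q.obj P ⟶ Z) : f = 0 :=
  have := hP.isKProjective
  have := hP.isStrictlyGE
  hom_eq_zero_of_isLE_of_isStrictlyGE (by lia : (-2 : ℤ) < -1) f

lemma finite_hom [FiniteDimensional k R] (L : CochainComplex (ModuleCat.{0} R) ℤ)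
    (hL : ∀ i, Module.Finite R (L.X i)) : Module.Finite k (Q.obj P ⟶ Q.obj L) := by
  have := hP.isKProjective
  have := hP.2.1
  have (i : ℤ) : Module.Finite k (P.X i ⟶ L.X i) := finite_moduleCat_hom _ _
  let φ : (P ⟶ L) →ₗ[k] (P.X (-1) ⟶ L.X (-1)) × (P.X 0 ⟶ L.X 0) :=
    { toFun f := (f.f (-1), f.f 0)
      map_add' _ _ := rfl
      map_smul' _ _ := rfl }
  have : Module.Finite k (P ⟶ L) := Module.Finite.of_injective φ fun f g h => by
    ext1 i
    by_cases h₁ : i = -1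
    · subst h₁
      exact congr_arg Prod.fst h
    by_cases h₀ : i = 0
    · subst h₀
      exact congr_arg Prod.snd h
    exact (hP.2.2 i h₁ h₀).eq_of_src _ _
  exact Module.Finite.of_surjective (Q.mapLinearMap k) (Q_map_surjective_of_isKProjective P L)

end IsTwoTermCplx

lemma IsTwoTermSilting.isConnective [FiniteDimensional k R]
    {P : CochainComplex (ModuleCat.{0} R) ℤ} (hP : IsTwoTermSilting R P) :
    IsConnective k (Q.obj P) (Q.obj P) where
  vanish i hi := by
    obtain rfl | hi := hi.eq_or_lt
    · exact hP.2.1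
    · have := hP.1.isLE
      have := TStructure.t.isLE_shift (Q.obj P) 0 i (-i) (by lia)
      exact hP.1.eq_zero_of_isLE (TStructure.t.isLE_of_le _ (-i) (-2) (by lia))
  finite i := by
    have := hP.1.finite_hom (k := k) (P⟦i⟧) fun j => hP.1.2.1 (j + i)
    let e : (Q.obj P)⟦i⟧ ≅ Q.obj (P⟦i⟧) := ((Q.commShiftIso i).app P).symm
    exact Module.Finite.of_injective (Linear.rightComp k (Q.obj P) e.hom) fun f g h =>
      (cancel_mono e.hom).1 h

lemma IsTwoTermSilting.isHereditarySilting [FiniteDimensional k R]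
    {P : CochainComplex (ModuleCat.{0} R) ℤ} (hP : IsTwoTermSilting R P)
    (hR : gldLE.{0, 0} R 1) :
    IsHereditarySilting k (Q.obj P) (TStructure.t (C := ModuleCat.{0} R)) where
  connective := hP.isConnective
  isLE_of_isConnective X hX := by
    have := hP.1.isLE
    have : Projective (ModuleCat.of R R) := (IsProjective.iff_projective (R := R) R).1 inferInstance
    exact isLE_zero_of_homVanish fun i hi => homVanish_of_eventually hP.isConnective
      (fun i hi => homVanish_single_of_isLE (by lia : 0 < i))
      (hP.2.2 _ (isThick_eventually_homVanish {X | IsConnective k (Q.obj P) X})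
        ⟨1, fun n hn X hX => hX.vanish n hn⟩ _ isPerfCplx_single) hX hi
  eq_zero_of_isLE _ hZ := hP.1.eq_zero_of_isLE hZ
  hereditary N Z _ _ _ f := by
    obtain ⟨M, ⟨e⟩⟩ := exists_iso_singleFunctor_obj_of_isGE_of_isLE N 0
    obtain ⟨S, hS, _, _, rfl⟩ := exists_projective_presentation hR M
    rw [← cancel_epi e.inv, comp_zero]
    exact homVanish_zero_iff.1 (homVanish_singleFunctor_of_shortExact hS) _

end Concrete

/-- If `A` is a finite dimensional algebra over a field `k` with
`gl.dim A ≤ 1` and `P` is a 2-term silting complex in `K^b(proj A)`, then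
`B = End_{D^b(A)}(P)` has global dimension at most `3`. -/
theorem gldim_end_le_three_of_gldim_le_one
    (k A : Type) [Field k] [Ring A] [Algebra k A] [FiniteDimensional k A]
    [HasDerivedCategory.{w} (ModuleCat.{0} Aᵐᵒᵖ)]
    (P : CochainComplex (ModuleCat.{0} Aᵐᵒᵖ) ℤ)
    (hP : IsTwoTermSilting Aᵐᵒᵖ P)
    (hgld : gldLE.{0, 0} Aᵐᵒᵖ 1) :
    gldLE.{w, w} (End (DerivedCategory.Q.obj P))ᵐᵒᵖ 3 := by
  exact (hP.isHereditarySilting (k := k) hgld).gldLE_three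

end

end TwoTermSilting
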